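/- Let n ∈ ℕ and L, C, R ∈ ℝ_max^{n×n}. The system (8) is consistent if and only if every entry of the Kleene star (M_[∞])* is different from +∞ (i.e., the precedence graph G(M_[∞]) contains no ∞-weight path). -/

import Mathlib

noncomputable section

open scoped Classical

/-- Max-plus matrix-vector product: `(A ⊗ x)_i = sup_j (A_{ij} + x_j)`. -/
def mpMulVec {N P : Type*} (A : N → P → EReal) (x : P → EReal) : N → EReal :=
  fun i => ⨆ j, A i j + x j

/-- Max-plus matrix-matrix product. -/
def mpMulMat {N P Q : Type*} (A : N → P → EReal) (B : P → Q → EReal) : N → Q → EReal :=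
  fun i j => ⨆ k, A i k + B k j

/-- Max-plus identity matrix `E`. -/
def mpId {N : Type*} [DecidableEq N] : N → N → EReal :=
  fun i j => if i = j then (0 : EReal) else ⊥

/-- Max-plus matrix powers: `A^0 = E`, `A^{k+1} = A^k ⊗ A`. -/
def mpPow {N : Type*} [DecidableEq N] (A : N → N → EReal) : ℕ → N → N → EReal
  | 0 => mpId
  | k + 1 => mpMulMat (mpPow A k) A

/-- Kleene star `A* = sup_{k ≥ 0} A^k` (entrywise supremum). -/
def mpStar {N : Type*} [DecidableEq N] (A : N → N → EReal) : N → N → EReal :=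
  fun i j => ⨆ k : ℕ, mpPow A k i j

/-- Image of a matrix: `Im U = { U ⊗ u : u ∈ ℝ_max^P } ⊆ ℝ_max^N`. -/
def mpIm {N P : Type*} (U : N → P → EReal) : Set (N → EReal) :=
  { x | (∀ i, x i ≠ ⊤) ∧ ∃ u : P → EReal, (∀ j, u j ≠ ⊤) ∧ x = mpMulVec U u }

/-- Existence of a positive-weight circuit in the precedence graph `G(A)`. -/
def hasPosCircuit {N : Type*} (A : N → N → EReal) : Prop :=
  ∃ (l : ℕ) (p : ℕ → N), p l = p 0 ∧ (∀ t < l, A (p (t + 1)) (p t) ≠ ⊥) ∧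
    0 < ∑ t ∈ Finset.range l, A (p (t + 1)) (p t)

/-- The block-tridiagonal matrix `M_[K]` with diagonal blocks `C`,
superdiagonal blocks `L`, subdiagonal blocks `R`. -/
def MK {n : ℕ} (L C R : Fin n → Fin n → EReal) (K : ℕ) :
    Fin K × Fin n → Fin K × Fin n → EReal :=
  fun p q =>
    if p.1.val = q.1.val then C p.2 q.2
    else if p.1.val + 1 = q.1.val then L p.2 q.2
    else if q.1.val + 1 = p.1.val then R p.2 q.2
    else ⊥

/-- The infinite block-tridiagonal matrix `M_[∞]`, indexed by `ℕ × Fin n`. -/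
def Minf {n : ℕ} (L C R : Fin n → Fin n → EReal) :
    ℕ × Fin n → ℕ × Fin n → EReal :=
  fun p q =>
    if p.1 = q.1 then C p.2 q.2
    else if p.1 + 1 = q.1 then L p.2 q.2
    else if q.1 + 1 = p.1 then R p.2 q.2
    else ⊥

/-- Existence of a finite real trajectory `x : {1,…,K} → ℝ^n` satisfying
`x(k) ≥ C ⊗ x(k)`, `x(k) ≥ L ⊗ x(k+1)` and `x(k+1) ≥ R ⊗ x(k)`. -/
def FiniteTraj {n : ℕ} (L C R : Fin n → Fin n → EReal) (K : ℕ) : Prop :=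
  ∃ x : Fin K → Fin n → ℝ,
    (∀ k : Fin K, ∀ i, mpMulVec C (fun j => (x k j : EReal)) i ≤ (x k i : EReal)) ∧
    (∀ k : Fin K, ∀ h : k.val + 1 < K, ∀ i,
      mpMulVec L (fun j => (x ⟨k.val + 1, h⟩ j : EReal)) i ≤ (x k i : EReal) ∧
      mpMulVec R (fun j => (x k j : EReal)) i ≤ (x ⟨k.val + 1, h⟩ i : EReal))

/-- Weak consistency of system (8). -/
def WeaklyConsistent {n : ℕ} (L C R : Fin n → Fin n → EReal) : Prop :=
  ∀ K : ℕ, FiniteTraj L C R K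

/-- Consistency of system (8): existence of an infinite real trajectory. -/
def Consistent {n : ℕ} (L C R : Fin n → Fin n → EReal) : Prop :=
  ∃ x : ℕ → Fin n → ℝ, ∀ k : ℕ,
    (∀ i, mpMulVec L (fun j => (x (k + 1) j : EReal)) i ≤ (x k i : EReal)) ∧
    (∀ i, mpMulVec C (fun j => (x k j : EReal)) i ≤ (x k i : EReal)) ∧
    (∀ i, mpMulVec R (fun j => (x k j : EReal)) i ≤ (x (k + 1) i : EReal))

/-- The sequence `Π_0 = C*`, `Π_{k+1} = (L ⊗ Π_k ⊗ R ⊕ C)*`. -/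
def PiSeq {n : ℕ} (L C R : Fin n → Fin n → EReal) : ℕ → Fin n → Fin n → EReal
  | 0 => mpStar C
  | k + 1 => mpStar (fun i j => max (mpMulMat (mpMulMat L (PiSeq L C R k)) R i j) (C i j))

/-- Lifted matrix `Ā = [[ε, E], [ε, ε]]`. -/
def Abar (n : ℕ) : Fin n ⊕ Fin n → Fin n ⊕ Fin n → EReal :=
  fun p q =>
    match p, q with
    | Sum.inl i, Sum.inr j => mpId i j
    | _, _ => ⊥

/-- Lifted matrix `B̄ = [ε; E]`. -/
def Bbar (n : ℕ) : Fin n ⊕ Fin n → Fin n → EReal :=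
  fun p j =>
    match p with
    | Sum.inl _ => ⊥
    | Sum.inr i => mpId i j

/-- Lifted matrix `H = [[C, L], [R, C]]`. -/
def Hmat {n : ℕ} (L C R : Fin n → Fin n → EReal) :
    Fin n ⊕ Fin n → Fin n ⊕ Fin n → EReal :=
  fun p q =>
    match p, q with
    | Sum.inl i, Sum.inl j => C i j
    | Sum.inl i, Sum.inr j => L i j
    | Sum.inr i, Sum.inl j => R i j
    | Sum.inr i, Sum.inr j => C i j

/-- The semimodule `K = Im H*`. -/
def Kset {n : ℕ} (L C R : Fin n → Fin n → EReal) : Set (Fin n ⊕ Fin n → EReal) :=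
  mpIm (mpStar (Hmat L C R))

/-- The map `φ(X) = X ∩ { x ∈ ℝ_max^N : ∃ u ∈ ℝ_max^M, A ⊗ x ⊕ B ⊗ u ∈ X }`. -/
def mpPhi {N M : Type*} (A : N → N → EReal) (B : N → M → EReal)
    (X : Set (N → EReal)) : Set (N → EReal) :=
  X ∩ { x | (∀ i, x i ≠ ⊤) ∧ ∃ u : M → EReal, (∀ j, u j ≠ ⊤) ∧
    (fun i => max (mpMulVec A x i) (mpMulVec B u i)) ∈ X }

/-- Controlled trajectory: `x(1) = x0`, `x(k+1) = A ⊗ x(k) ⊕ B ⊗ u(k)`. -/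
def mpTraj {N M : Type*} (A : N → N → EReal) (B : N → M → EReal)
    (x0 : N → EReal) (u : ℕ → M → EReal) : ℕ → N → EReal
  | 0 => x0
  | k + 1 => fun i => max (mpMulVec A (mpTraj A B x0 u k) i) (mpMulVec B (u k) i)

/-- `K^♯`: states of `K` from which some control keeps the whole trajectory in `K`. -/
def mpKsharp {N M : Type*} (A : N → N → EReal) (B : N → M → EReal)
    (K : Set (N → EReal)) : Set (N → EReal) :=
  { x | x ∈ K ∧ ∃ u : ℕ → M → EReal, (∀ k j, u k j ≠ ⊤) ∧
    ∀ k : ℕ, mpTraj A B x u k ∈ K }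

/-- Real vectors `ℝ^N` inside `ℝ̄^N`. -/
def RealVecs {N : Type*} : Set (N → EReal) := { x | ∀ i, x i ≠ ⊤ ∧ x i ≠ ⊥ }

/-- Semimodules of `ℝ_max^N`: closed under entrywise max and scalar addition. -/
def IsSemimodule {N : Type*} (X : Set (N → EReal)) : Prop :=
  (∀ x ∈ X, ∀ i, x i ≠ ⊤) ∧
  (∀ x ∈ X, ∀ y ∈ X, (fun i => max (x i) (y i)) ∈ X) ∧
  (∀ x ∈ X, ∀ lam : EReal, lam ≠ ⊤ → (fun i => lam + x i) ∈ X)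

/-- Embedding of the first two block indices into `Fin (k+2) × Fin n`. -/
def emb2 {n : ℕ} (k : ℕ) : Fin n ⊕ Fin n → Fin (k + 2) × Fin n
  | Sum.inl i => (⟨0, by omega⟩, i)
  | Sum.inr i => (⟨1, by omega⟩, i)

/-- `S_{k+2}`: top-left `2n × 2n` submatrix of `(M_[k+2])*`. -/
def Smat {n : ℕ} (L C R : Fin n → Fin n → EReal) (k : ℕ) :
    Fin n ⊕ Fin n → Fin n ⊕ Fin n → EReal :=
  fun p q => mpStar (MK L C R (k + 2)) (emb2 k p) (emb2 k q)

/-- Embedding of the first two block indices into `ℕ × Fin n`. -/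
def embInf {n : ℕ} : Fin n ⊕ Fin n → ℕ × Fin n
  | Sum.inl i => (0, i)
  | Sum.inr i => (1, i)

/-- `S_∞`: top-left `2n × 2n` submatrix of `(M_[∞])*`. -/
def Sinf {n : ℕ} (L C R : Fin n → Fin n → EReal) :
    Fin n ⊕ Fin n → Fin n ⊕ Fin n → EReal :=
  fun p q => mpStar (Minf L C R) (embInf p) (embInf q)

lemma EReal.add_iSup_le_of_forall {ι : Type*} {a b : EReal} {f : ι → EReal} (ha : a ≠ ⊤)
    (h : ∀ i, a + f i ≤ b) : a + ⨆ i, f i ≤ b := by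
  induction a with
  | bot => simp
  | top => exact absurd rfl ha
  | coe r =>
    rw [add_comm, ← EReal.le_sub_iff_add_le (by simp) (by simp)]
    refine iSup_le fun i => ?_
    rw [EReal.le_sub_iff_add_le (by simp) (by simp), add_comm]
    exact h i

section KleeneStar

variable {N : Type*} [DecidableEq N] {A : N → N → EReal}

lemma mpPow_add_le (x : N → ℝ) (hx : ∀ i j, A i j + x j ≤ x i) (k : ℕ) (i j : N) :
    mpPow A k i j + x j ≤ x i := by
  induction k generalizing j with
  | zero =>
    by_cases h : i = j
    · simp [mpPow, mpId, h]
    · simp [mpPow, mpId, h]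
  | succ k ih =>
    rw [add_comm]
    refine EReal.add_iSup_le_of_forall (EReal.coe_ne_top _) fun l => ?_
    rw [add_comm, add_assoc]
    exact (add_le_add_right (hx l j) _).trans (ih l)

lemma mpStar_ne_top_of_add_le (x : N → ℝ) (hx : ∀ i j, A i j + x j ≤ x i) (i j : N) :
    mpStar A i j ≠ ⊤ := by
  have h : mpStar A i j ≤ ((x i - x j : ℝ) : EReal) := by
    refine iSup_le fun k => ?_
    rw [EReal.coe_sub, EReal.le_sub_iff_add_le (by simp) (by simp)]
    exact mpPow_add_le x hx k i j
  exact ne_top_of_le_ne_top (EReal.coe_ne_top _) h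

lemma add_mpPow_le_mpPow_succ (hA : ∀ i j, A i j ≠ ⊤) (m : ℕ) (i j k : N) :
    A i j + mpPow A m j k ≤ mpPow A (m + 1) i k := by
  induction m generalizing k with
  | zero =>
    by_cases h : j = k
    · subst h
      refine le_trans ?_ (le_iSup _ i)
      simp [mpPow, mpId]
    · simp [mpPow, mpId, h]
  | succ m ih =>
    refine EReal.add_iSup_le_of_forall (hA i j) fun l => ?_
    rw [← add_assoc]
    exact (add_le_add_left (ih l) _).trans
      (le_iSup (fun l => mpPow A (m + 1) i l + A l k) l)

lemma add_mpStar_le (hA : ∀ i j, A i j ≠ ⊤) (i j k : N) :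
    A i j + mpStar A j k ≤ mpStar A i k :=
  EReal.add_iSup_le_of_forall (hA i j) fun m =>
    (add_mpPow_le_mpPow_succ hA m i j k).trans (le_iSup (fun m => mpPow A m i k) (m + 1))

lemma zero_le_mpStar_self (i : N) : 0 ≤ mpStar A i i := by
  refine le_trans ?_ (le_iSup _ 0)
  simp [mpPow, mpId]

/-- The columns of a matrix over a countable index set without `+∞` entries can be shifted by
real numbers so that the row suprema do not reach `+∞`. -/
lemma exists_real_iSup_add_ne_top {N : Type*} [Countable N] (S : N → N → EReal)
    (hS : ∀ i j, S i j ≠ ⊤) : ∃ c : N → ℝ, ∀ i, ⨆ j, (S i j + c j) ≠ ⊤ := by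
  obtain ⟨f, hf⟩ := exists_injective_nat N
  have hfin (m : ℕ) : {i | f i ≤ m}.Finite := (Set.finite_Iic m).preimage hf.injOn
  have hc (j : N) : ∃ c : ℝ, ∀ i, f i ≤ f j → S i j + c ≤ 0 := by
    have hlt : (hfin (f j)).toFinset.sup (fun i => S i j) < ⊤ :=
      (Finset.sup_lt_iff bot_lt_top).2 fun i _ => (hS i j).lt_top
    obtain ⟨b, hb, -⟩ := EReal.lt_iff_exists_real_btwn.1 hlt
    refine ⟨-b, fun i hi => ?_⟩
    have hle : S i j ≤ b :=
      (Finset.le_sup (f := fun i => S i j) ((hfin (f j)).mem_toFinset.2 hi)).trans hb.le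
    rw [EReal.coe_neg, ← sub_eq_add_neg]
    exact EReal.sub_nonpos.2 hle
  choose c hc using hc
  refine ⟨c, fun i => ?_⟩
  have hlt : (hfin (f i)).toFinset.sup (fun j => S i j + c j) < ⊤ :=
    (Finset.sup_lt_iff bot_lt_top).2 fun j _ =>
      EReal.add_lt_top (hS i j) (EReal.coe_ne_top _)
  refine ne_top_of_le_ne_top (max_lt EReal.zero_lt_top hlt).ne (iSup_le fun j => ?_)
  rcases le_total (f i) (f j) with h | h
  · exact (hc j i h).trans (le_max_left _ _)
  · exact (Finset.le_sup (f := fun j => S i j + c j)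
      ((hfin (f i)).mem_toFinset.2 h)).trans (le_max_right _ _)

/-- A max-plus matrix over a countable index set has a real subsolution of `A ⊗ x ≤ x` if and only
if its Kleene star has no entry `+∞`. -/
theorem exists_real_add_le_iff_mpStar_ne_top [Countable N] (hA : ∀ i j, A i j ≠ ⊤) :
    (∃ x : N → ℝ, ∀ i j, A i j + x j ≤ x i) ↔ ∀ i j, mpStar A i j ≠ ⊤ := by
  refine ⟨fun ⟨x, hx⟩ => mpStar_ne_top_of_add_le x hx, fun h => ?_⟩
  obtain ⟨c, hc⟩ := exists_real_iSup_add_ne_top (mpStar A) h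
  have hbot (i : N) : ⨆ j, (mpStar A i j + c j) ≠ ⊥ := by
    refine ne_bot_of_le_ne_bot (EReal.coe_ne_bot (c i)) ?_
    refine le_trans ?_ (le_iSup _ i)
    simpa using add_le_add_left (zero_le_mpStar_self (A := A) i) (c i : EReal)
  refine ⟨fun i => (⨆ j, (mpStar A i j + c j)).toReal, fun i j => ?_⟩
  rw [EReal.coe_toReal (hc i) (hbot i), EReal.coe_toReal (hc j) (hbot j)]
  refine EReal.add_iSup_le_of_forall (hA i j) fun k => ?_
  rw [← add_assoc]
  exact (add_le_add_left (add_mpStar_le hA i j k) _).trans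
    (le_iSup (fun k => mpStar A i k + (c k : EReal)) k)

end KleeneStar

lemma Minf_ne_top {n : ℕ} {L C R : Fin n → Fin n → EReal}
    (hL : ∀ i j, L i j ≠ ⊤) (hC : ∀ i j, C i j ≠ ⊤) (hR : ∀ i j, R i j ≠ ⊤)
    (p q : ℕ × Fin n) : Minf L C R p q ≠ ⊤ := by
  unfold Minf
  split_ifs
  exacts [hC _ _, hL _ _, hR _ _, bot_ne_top]

lemma consistent_iff_exists_Minf_add_le {n : ℕ} {L C R : Fin n → Fin n → EReal} :
    Consistent L C R ↔
      ∃ x : ℕ × Fin n → ℝ, ∀ p q, Minf L C R p q + x q ≤ x p := by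
  simp only [Consistent, mpMulVec, iSup_le_iff]
  constructor
  · rintro ⟨x, hx⟩
    refine ⟨fun p => x p.1 p.2, ?_⟩
    rintro ⟨k, i⟩ ⟨l, j⟩
    by_cases h₁ : k = l
    · subst h₁
      simpa [Minf] using (hx k).2.1 i j
    by_cases h₂ : k + 1 = l
    · subst h₂
      simpa [Minf] using (hx k).1 i j
    by_cases h₃ : l + 1 = k
    · subst h₃
      simpa [Minf, add_assoc] using (hx l).2.2 i j
    · simp [Minf, h₁, h₂, h₃]
  · rintro ⟨x, hx⟩
    refine ⟨fun k i => x (k, i), fun k => ⟨fun i j => ?_, fun i j => ?_, fun i j => ?_⟩⟩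
    · simpa [Minf] using hx (k, i) (k + 1, j)
    · simpa [Minf] using hx (k, i) (k, j)
    · simpa [Minf, add_assoc] using hx (k + 1, i) (k, j)

/-- system (8) is consistent iff every entry of `(M_[∞])*` is
different from `+∞`. -/
theorem stmt_6 (n : ℕ) (hn : 0 < n) (L C R : Fin n → Fin n → EReal)
    (hL : ∀ i j, L i j ≠ ⊤) (hC : ∀ i j, C i j ≠ ⊤) (hR : ∀ i j, R i j ≠ ⊤) :
    Consistent L C R ↔ ∀ p q, mpStar (Minf L C R) p q ≠ ⊤ := by
  rw [consistent_iff_exists_Minf_add_le]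
  exact exists_real_add_le_iff_mpStar_ne_top (Minf_ne_top hL hC hR)
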